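/- Let p be a positive integer, let ξ : ℝ^p → ℝ be L_ξ-smooth (differentiable with L_ξ-Lipschitz gradient), and let δ > 0. Then the smoothed function ξ_δ(w) = E_{v'∼U(B_p)}[ξ(w + δv')] is differentiable and, for every w ∈ ℝ^p, the one-point estimator is unbiased for its gradient: E_{v∼U(S_{p−1})}[(p/δ) ξ(w + δv) v] = ∇ξ_δ(w). -/

import Mathlib

open MeasureTheory Metric

/-- The uniform probability measure on the closed unit ball `B_p ⊆ ℝ^p`. -/
noncomputable def ballUniform (p : ℕ) : Measure (EuclideanSpace ℝ (Fin p)) :=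
  (volume (closedBall (0 : EuclideanSpace ℝ (Fin p)) 1))⁻¹ •
    (volume : Measure (EuclideanSpace ℝ (Fin p))).restrict (closedBall 0 1)

/-- The uniform (normalized surface) probability measure on the unit sphere
`S_{p-1} ⊆ ℝ^p`, viewed as a measure on the ambient space. -/
noncomputable def sphereUniform (p : ℕ) : Measure (EuclideanSpace ℝ (Fin p)) :=
  ((volume : Measure (EuclideanSpace ℝ (Fin p))).toSphere Set.univ)⁻¹ •
    Measure.map Subtype.val (volume : Measure (EuclideanSpace ℝ (Fin p))).toSphere

open Set in
lemma aux_polar {E : Type*} [NormedAddCommGroup E] [NormedSpace ℝ E] [Nontrivial E]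
    [MeasurableSpace E] [FiniteDimensional ℝ E] [BorelSpace E] (μ : Measure E)
    [μ.IsAddHaarMeasure] (f : E → ℝ) (hf : Integrable f μ) :
    ∫ x, f x ∂μ = ∫ r in Ioi (0:ℝ), r ^ (Module.finrank ℝ E - 1) *
      ∫ v : sphere (0:E) 1, f (r • (v:E)) ∂μ.toSphere := by
  have hmp := μ.measurePreserving_homeomorphUnitSphereProd
  have hemb := (homeomorphUnitSphereProd E).measurableEmbedding
  have key : ∀ x : ({(0)}ᶜ : Set E),
      f (((homeomorphUnitSphereProd E x).2 : ℝ) • ((homeomorphUnitSphereProd E x).1 : E)) = f x := by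
    intro x
    have h0 : ‖(x:E)‖ ≠ 0 := norm_ne_zero_iff.2 x.2
    simp [smul_smul, h0]
  have hint : Integrable (fun z : sphere (0:E) 1 × Ioi (0:ℝ) => f ((z.2:ℝ) • (z.1:E)))
      (μ.toSphere.prod (.volumeIoiPow (Module.finrank ℝ E - 1))) := by
    rw [← hmp.integrable_comp_emb hemb]
    have : ((fun z : sphere (0:E) 1 × Ioi (0:ℝ) => f ((z.2:ℝ) • (z.1:E))) ∘
      (homeomorphUnitSphereProd E)) = f ∘ Subtype.val := by
      ext x; exact key x
    rw [this, ← integrableOn_iff_comap_subtypeVal (measurableSet_singleton _).compl]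
    exact hf.integrableOn
  calc
    ∫ x, f x ∂μ = ∫ x : ({(0)}ᶜ : Set E), f x.1 ∂(μ.comap (↑)) := by
      rw [integral_subtype_comap (measurableSet_singleton _).compl fun x ↦ f x,
        MeasureTheory.restrict_compl_singleton]
    _ = ∫ z : sphere (0:E) 1 × Ioi (0:ℝ), f ((z.2:ℝ) • (z.1:E))
          ∂μ.toSphere.prod (.volumeIoiPow (Module.finrank ℝ E - 1)) := by
      rw [← hmp.integral_comp hemb]
      simp only [key]
    _ = ∫ r : Ioi (0:ℝ), ∫ v : sphere (0:E) 1, f ((r:ℝ) • (v:E)) ∂μ.toSphere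
          ∂(.volumeIoiPow (Module.finrank ℝ E - 1)) := by
      rw [integral_prod_symm _ hint]
    _ = _ := by
      simp only [Measure.volumeIoiPow, ENNReal.ofReal]
      rw [integral_withDensity_eq_integral_smul,
        integral_subtype_comap measurableSet_Ioi fun a ↦ Real.toNNReal (a ^ (Module.finrank ℝ E - 1)) •
          ∫ v : sphere (0:E) 1, f (a • (v:E)) ∂μ.toSphere,
        setIntegral_congr_fun measurableSet_Ioi fun x hx ↦ ?_]
      · rw [NNReal.smul_def, Real.coe_toNNReal _ (pow_nonneg hx.out.le _), smul_eq_mul]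
      · exact (measurable_subtype_coe.pow_const _).real_toNNReal

open Set in
lemma aux_polar_ball {E : Type*} [NormedAddCommGroup E] [NormedSpace ℝ E] [Nontrivial E]
    [MeasurableSpace E] [FiniteDimensional ℝ E] [BorelSpace E] (μ : Measure E)
    [μ.IsAddHaarMeasure] (c : ℝ → ℝ) (k : E → ℝ) (hc : Continuous c) (hk : Continuous k)
    (R : ℝ) (hR : 0 < R) :
    ∫ x in closedBall (0:E) R, c ‖x‖ * k x ∂μ = ∫ r in (0:ℝ)..R, c r *
      (r ^ (Module.finrank ℝ E - 1) * ∫ v : sphere (0:E) 1, k (r • (v:E)) ∂μ.toSphere) := by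
  have : ProperSpace E := FiniteDimensional.proper ℝ E
  have hcont : Continuous (fun x : E => c ‖x‖ * k x) := by fun_prop
  rw [← integral_indicator measurableSet_closedBall, aux_polar, intervalIntegral.integral_of_le hR.le,
    ← integral_indicator measurableSet_Ioi, ← integral_indicator measurableSet_Ioc]
  · congr 1
    ext r
    by_cases h0 : 0 < r
    · have hn : ∀ v : sphere (0:E) 1, ‖r • (v:E)‖ = r := by
        intro v; simp [norm_smul, abs_of_pos h0]
      by_cases h1 : r ≤ R
      · have hm : ∀ v : sphere (0:E) 1, r • (v:E) ∈ closedBall (0:E) R := by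
          intro v; simpa only [mem_closedBall_zero_iff, hn] using h1
        rw [indicator_of_mem (show r ∈ Ioi 0 from h0), indicator_of_mem (show r ∈ Ioc 0 R from ⟨h0, h1⟩)]
        simp only [indicator_of_mem (hm _), hn, integral_const_mul]
        ring
      · have hm : ∀ v : sphere (0:E) 1, r • (v:E) ∉ closedBall (0:E) R := by
          intro v; simpa only [mem_closedBall_zero_iff, hn] using h1
        rw [indicator_of_mem (show r ∈ Ioi 0 from h0), indicator_of_notMem (fun h => h1 h.2)]
        simp only [indicator_of_notMem (hm _), integral_zero, mul_zero]
    · rw [indicator_of_notMem (show r ∉ Ioi 0 from h0), indicator_of_notMem (fun h => h0 h.1)]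
  · rw [integrable_indicator_iff measurableSet_closedBall]
    exact hcont.continuousOn.integrableOn_compact (isCompact_closedBall _ _)

lemma aux_sq (s : ℝ) : HasDerivAt (fun s : ℝ => (max s 0) ^ 2) (2 * max s 0) s := by
  rcases lt_trichotomy s 0 with h | h | h
  · have : (fun s : ℝ => (max s 0) ^ 2) =ᶠ[nhds s] fun _ => 0 := by
      filter_upwards [Iio_mem_nhds h] with t ht
      simp [max_eq_right (le_of_lt (Set.mem_Iio.1 ht))]
    rw [max_eq_right h.le, mul_zero]
    exact (hasDerivAt_const s (0:ℝ)).congr_of_eventuallyEq this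
  · subst h
    rw [hasDerivAt_iff_isLittleO]
    simp only [max_self, mul_zero, smul_zero, sub_zero]
    rw [Asymptotics.isLittleO_iff]
    intro c hc
    filter_upwards [Metric.ball_mem_nhds (0:ℝ) hc] with t ht
    have ht : |t| < c := by simpa using ht
    have h1 : max t 0 ≤ |t| := max_le (le_abs_self t) (abs_nonneg t)
    have h2 : 0 ≤ max t 0 := le_max_right _ _
    simp only [Real.norm_eq_abs]
    rw [show max t 0 ^ 2 - 0 ^ 2 = max t 0 ^ 2 by ring, abs_of_nonneg (by positivity)]
    nlinarith [abs_nonneg t]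
  · have : (fun s : ℝ => (max s 0) ^ 2) =ᶠ[nhds s] fun s => s ^ 2 := by
      filter_upwards [Ioi_mem_nhds h] with t ht
      simp [max_eq_left (le_of_lt (Set.mem_Ioi.1 ht))]
    rw [max_eq_left h.le]
    simpa using (hasDerivAt_pow 2 s).congr_of_eventuallyEq this

lemma aux_diff (h F : ℝ → ℝ) (hh : Continuous h) (hF : Continuous F)
    (H : ∀ R : ℝ, 0 < R → ∫ r in (0:ℝ)..R, (R ^ 2 - r ^ 2) ^ 2 * h r =
      ∫ r in (0:ℝ)..R, (4 * (R ^ 2 - r ^ 2)) * (r * F r)) (R : ℝ) (hR : 0 < R) :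
    ∫ r in (0:ℝ)..R, h r = F R := by
  have D : ∀ f : ℝ → ℝ, Continuous f → ∀ R, HasDerivAt (fun R => ∫ r in (0:ℝ)..R, f r) (f R) R :=
    fun f hf R => intervalIntegral.integral_hasDerivAt_right (hf.intervalIntegrable _ _)
      (hf.stronglyMeasurableAtFilter _ _) hf.continuousAt
  have I : ∀ f : ℝ → ℝ, Continuous f → ∀ R, IntervalIntegrable f volume 0 R :=
    fun f hf R => hf.intervalIntegrable _ _
  have c2 : Continuous fun r => r ^ 2 * h r := by fun_prop
  have c4 : Continuous fun r => r ^ 4 * h r := by fun_prop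
  have d1 : Continuous fun r => r * F r := by fun_prop
  have d3 : Continuous fun r => r ^ 3 * F r := by fun_prop
  have E1 : ∀ R : ℝ, 0 < R → R ^ 4 * (∫ r in (0:ℝ)..R, h r) - 2 * R ^ 2 * (∫ r in (0:ℝ)..R, r ^ 2 * h r)
      + (∫ r in (0:ℝ)..R, r ^ 4 * h r) =
      4 * R ^ 2 * (∫ r in (0:ℝ)..R, r * F r) - 4 * (∫ r in (0:ℝ)..R, r ^ 3 * F r) := by
    intro R hR
    have := H R hR
    simp only [← intervalIntegral.integral_const_mul]
    rw [← intervalIntegral.integral_sub, ← intervalIntegral.integral_add, ← intervalIntegral.integral_sub]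
    · convert this using 1 <;> (congr 1; ext r; ring)
    all_goals (apply Continuous.intervalIntegrable; fun_prop)
  have E2 : ∀ R : ℝ, 0 < R → R ^ 2 * (∫ r in (0:ℝ)..R, h r) - (∫ r in (0:ℝ)..R, r ^ 2 * h r) =
      2 * (∫ r in (0:ℝ)..R, r * F r) := by
    intro R hR
    have l := (((hasDerivAt_pow 4 R).mul (D h hh R)).sub
      ((((hasDerivAt_pow 2 R).const_mul 2)).mul (D _ c2 R))).add (D _ c4 R)
    have r := ((((hasDerivAt_pow 2 R).const_mul 4)).mul (D _ d1 R)).sub ((D _ d3 R).const_mul 4)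
    have e := l.unique (r.congr_of_eventuallyEq (by
      filter_upwards [Ioi_mem_nhds hR] with t ht
      exact E1 t ht))
    norm_num at e
    have : (4 * R) * (R ^ 2 * (∫ r in (0:ℝ)..R, h r) - (∫ r in (0:ℝ)..R, r ^ 2 * h r)) =
      (4 * R) * (2 * (∫ r in (0:ℝ)..R, r * F r)) := by linear_combination e
    exact mul_left_cancel₀ (by positivity) this
  have l := ((hasDerivAt_pow 2 R).mul (D h hh R)).sub (D _ c2 R)
  have r := (D _ d1 R).const_mul 2
  have e := l.unique (r.congr_of_eventuallyEq (by
      filter_upwards [Ioi_mem_nhds hR] with t ht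
      exact E2 t ht))
  norm_num at e
  have : (2 * R) * (∫ r in (0:ℝ)..R, h r) = (2 * R) * F R := by linear_combination e
  exact mul_left_cancel₀ (by positivity) this

lemma aux_ibp {E : Type*} [NormedAddCommGroup E] [InnerProductSpace ℝ E]
    [MeasurableSpace E] [FiniteDimensional ℝ E] [BorelSpace E] (μ : Measure E)
    [μ.IsAddHaarMeasure] (g : E → ℝ) (hg : ContDiff ℝ 1 g) (u : E) (R : ℝ) (hR : 0 < R) :
    ∫ x in closedBall (0:E) R, (R ^ 2 - ‖x‖ ^ 2) ^ 2 * fderiv ℝ g x u ∂μ =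
    ∫ x in closedBall (0:E) R, (4 * (R ^ 2 - ‖x‖ ^ 2)) * (inner ℝ x u * g x) ∂μ := by
  have : ProperSpace E := FiniteDimensional.proper ℝ E
  have hle : ∀ x : E, x ∉ closedBall (0:E) R → R ^ 2 - ‖x‖ ^ 2 ≤ 0 := by
    intro x hx
    have : R < ‖x‖ := by simpa using hx
    nlinarith
  have hge : ∀ x : E, x ∈ closedBall (0:E) R → 0 ≤ R ^ 2 - ‖x‖ ^ 2 := by
    intro x hx
    have : ‖x‖ ≤ R := by simpa using hx
    nlinarith [norm_nonneg x]
  set φ : E → ℝ := fun x => (max (R ^ 2 - ‖x‖ ^ 2) 0) ^ 2 with hφ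
  have hd : ∀ x, HasFDerivAt φ ((2 * max (R ^ 2 - ‖x‖ ^ 2) 0) • (-((2:ℝ) • innerSL ℝ x))) x := by
    intro x
    have h1 : HasFDerivAt (fun x : E => R ^ 2 - ‖x‖ ^ 2) (-((2:ℝ) • innerSL ℝ x)) x := by
      have := (hasStrictFDerivAt_norm_sq x).hasFDerivAt.const_sub (R ^ 2)
      refine this.congr_fderiv ?_
      ext; simp
    exact (aux_sq _).comp_hasFDerivAt x h1
  have hfd : ∀ x, fderiv ℝ φ x u = -(4 * max (R ^ 2 - ‖x‖ ^ 2) 0 * inner ℝ x u) := by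
    intro x
    rw [(hd x).fderiv]; simp; ring
  have hg' : Continuous (fun x => fderiv ℝ g x u) := (hg.continuous_fderiv (by norm_num)).clm_apply continuous_const
  have hgc := hg.continuous
  have hint : ∀ f : E → ℝ, Continuous f → (∀ x, x ∉ closedBall (0:E) R → f x = 0) → Integrable f μ := by
    intro f hf hs
    exact hf.integrable_of_hasCompactSupport (HasCompactSupport.intro (isCompact_closedBall _ _) hs)
  have key := integral_mul_fderiv_eq_neg_fderiv_mul_of_integrable (μ := μ) (f := φ) (g := g) (v := u)
    (by
      simp only [hfd]
      apply hint
      · fun_prop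
      · intro x hx; simp [max_eq_right (hle x hx)])
    (by
      apply hint
      · fun_prop
      · intro x hx; simp [hφ, max_eq_right (hle x hx)])
    (by
      apply hint
      · fun_prop
      · intro x hx; simp [hφ, max_eq_right (hle x hx)])
    (fun x _ => (hd x).differentiableAt)
    (fun x _ => (hg.differentiable (by norm_num)) x)
  rw [← integral_neg, ← setIntegral_eq_integral_of_forall_compl_eq_zero (s := closedBall (0:E) R) (f := fun x => φ x * fderiv ℝ g x u),
    ← setIntegral_eq_integral_of_forall_compl_eq_zero (s := closedBall (0:E) R) (f := fun x => -(fderiv ℝ φ x u * g x))] at key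
  · rw [setIntegral_congr_fun measurableSet_closedBall (g := fun x => φ x * fderiv ℝ g x u), key]
    · apply setIntegral_congr_fun measurableSet_closedBall
      intro x hx
      simp only [hfd, max_eq_left (hge x hx)]; ring
    · intro x hx
      simp only [hφ, max_eq_left (hge x hx)]
  · intro x hx; simp [hfd, max_eq_right (hle x hx)]
  · intro x hx; simp [hφ, max_eq_right (hle x hx)]

lemma aux_stokes {E : Type*} [NormedAddCommGroup E] [InnerProductSpace ℝ E] [Nontrivial E]
    [MeasurableSpace E] [FiniteDimensional ℝ E] [BorelSpace E] (μ : Measure E)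
    [μ.IsAddHaarMeasure] (g : E → ℝ) (hg : ContDiff ℝ 1 g) (u : E) :
    ∫ x in closedBall (0:E) 1, fderiv ℝ g x u ∂μ =
    ∫ v : sphere (0:E) 1, inner ℝ (v:E) u * g v ∂μ.toSphere := by
  have : ProperSpace E := FiniteDimensional.proper ℝ E
  have hg' : Continuous (fun x => fderiv ℝ g x u) := (hg.continuous_fderiv (by norm_num)).clm_apply continuous_const
  have hgc := hg.continuous
  have hpar : ∀ k : ℝ → sphere (0:E) 1 → ℝ, Continuous k.uncurry →
      Continuous (fun r => ∫ v : sphere (0:E) 1, k r v ∂μ.toSphere) := by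
    intro k hk
    have := continuous_parametric_integral_of_continuous (μ := μ.toSphere) hk isCompact_univ
    simpa using this
  have h := aux_diff
    (fun r => r ^ (Module.finrank ℝ E - 1) * ∫ v : sphere (0:E) 1, fderiv ℝ g (r • (v:E)) u ∂μ.toSphere)
    (fun r => r ^ (Module.finrank ℝ E - 1) * ∫ v : sphere (0:E) 1, inner ℝ (v:E) u * g (r • (v:E)) ∂μ.toSphere)
    (by
      refine Continuous.mul (by fun_prop) (hpar _ ?_)
      exact hg'.comp (f := fun z : ℝ × sphere (0:E) 1 => z.1 • (z.2:E)) (by fun_prop))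
    (by
      refine Continuous.mul (by fun_prop) (hpar _ ?_)
      unfold Function.uncurry
      fun_prop)
    (by
      intro R hR
      have := aux_ibp μ g hg u R hR
      rw [aux_polar_ball μ (fun r => (R ^ 2 - r ^ 2) ^ 2) _ (by fun_prop) hg' R hR,
        aux_polar_ball μ (fun r => 4 * (R ^ 2 - r ^ 2)) (fun x => inner ℝ x u * g x) (by fun_prop)
          (by fun_prop) R hR] at this
      rw [this]
      congr 1
      ext r
      simp only [inner_smul_left, mul_assoc, integral_const_mul]
      simp
      left; ring) 1 one_pos
  have h2 := aux_polar_ball μ (fun _ => 1) _ (by fun_prop) hg' 1 one_pos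
  simp only [one_mul] at h2
  rw [h2, h]
  simp

theorem smoothed_unbiased_gradient_estimate
    (p : ℕ) (hp : 0 < p) (ξ : EuclideanSpace ℝ (Fin p) → ℝ) (Lξ : ℝ) (hLξ : 0 ≤ Lξ)
    (hdiff : Differentiable ℝ ξ)
    (hlip : LipschitzWith Lξ.toNNReal (fun x => gradient ξ x))
    (δ : ℝ) (hδ : 0 < δ) :
    Differentiable ℝ (fun w => ∫ v', ξ (w + δ • v') ∂(ballUniform p)) ∧
    ∀ w : EuclideanSpace ℝ (Fin p),
      (∫ v, (((p : ℝ) / δ) * ξ (w + δ • v)) • v ∂(sphereUniform p))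
        = gradient (fun w => ∫ v', ξ (w + δ • v') ∂(ballUniform p)) w := by
  have : Nonempty (Fin p) := ⟨⟨0, hp⟩⟩
  have hfc : Continuous (fderiv ℝ ξ) := by
    have : fderiv ℝ ξ = fun x => InnerProductSpace.toDual ℝ _ (gradient ξ x) := by
      ext1 x; simp [gradient]
    rw [this]
    exact (InnerProductSpace.toDual ℝ _).continuous.comp hlip.continuous
  have hC1 : ContDiff ℝ 1 ξ := contDiff_one_iff_fderiv.2 ⟨hdiff, hfc⟩
  have hξc := hdiff.continuous
  set V := (volume (closedBall (0 : EuclideanSpace ℝ (Fin p)) 1)) with hV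
  have hVpos : 0 < V := measure_closedBall_pos _ _ one_pos
  have hVtop : V < ⊤ := measure_closedBall_lt_top
  have hVr : 0 < V.toReal := ENNReal.toReal_pos hVpos.ne' hVtop.ne
  have hint : ∀ {G : Type} [NormedAddCommGroup G] (f : EuclideanSpace ℝ (Fin p) → G),
      Continuous f → Integrable f (ballUniform p) := by
    intro G _ f hf
    apply Integrable.smul_measure _ (ENNReal.inv_ne_top.2 hVpos.ne')
    exact hf.continuousOn.integrableOn_compact (isCompact_closedBall _ _)
  have hder : ∀ w, HasFDerivAt (fun w => ∫ v', ξ (w + δ • v') ∂(ballUniform p))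
      (∫ v', fderiv ℝ ξ (w + δ • v') ∂(ballUniform p)) w := by
    intro w
    obtain ⟨C, hC⟩ := (isCompact_closedBall w (1 + δ)).exists_bound_of_continuousOn hfc.continuousOn
    refine hasFDerivAt_integral_of_dominated_of_fderiv_le (s := ball w 1)
      (F := fun w v' => ξ (w + δ • v')) (F' := fun w v' => fderiv ℝ ξ (w + δ • v'))
      (bound := fun _ => C) (ball_mem_nhds w one_pos)
      (Filter.Eventually.of_forall fun x => (hint _ (by fun_prop)).aestronglyMeasurable)
      (hint _ (by fun_prop)) (hint _ (by fun_prop)).aestronglyMeasurable ?_ (hint _ (by fun_prop)) ?_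
    · have : ∀ᵐ a ∂(ballUniform p), a ∈ closedBall (0 : EuclideanSpace ℝ (Fin p)) 1 :=
        Measure.ae_smul_measure (ae_restrict_mem measurableSet_closedBall) _
      filter_upwards [this] with a ha x hx
      apply hC
      rw [mem_closedBall_zero_iff] at ha
      rw [mem_ball_iff_norm] at hx
      rw [mem_closedBall_iff_norm, show x + δ • a - w = (x - w) + δ • a by abel]
      refine (norm_add_le _ _).trans ?_
      rw [norm_smul, Real.norm_of_nonneg hδ.le]
      nlinarith
    · refine Filter.Eventually.of_forall fun a x _ => ?_
      exact (hasFDerivAt_comp_add_right (δ • a)).2 (hdiff (x + δ • a)).hasFDerivAt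
  refine ⟨fun w => (hder w).differentiableAt, fun w => ?_⟩
  refine ext_inner_right ℝ fun u => ?_
  have hg : ContDiff ℝ 1 (fun x => ξ (w + δ • x)) := by fun_prop
  have hst := aux_stokes volume (fun x => ξ (w + δ • x)) hg u
  have hgd : ∀ x, fderiv ℝ (fun x => ξ (w + δ • x)) x u = δ * fderiv ℝ ξ (w + δ • x) u := by
    intro x
    have h1 : HasFDerivAt (fun x : EuclideanSpace ℝ (Fin p) => w + δ • x)
      (δ • ContinuousLinearMap.id ℝ _) x := ((hasFDerivAt_id x).const_smul δ).const_add w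
    have := (hdiff (w + δ • x)).hasFDerivAt.comp x h1
    have h2 : fderiv ℝ (fun x => ξ (w + δ • x)) x = _ := this.fderiv
    rw [h2]; simp
  simp only [hgd, integral_const_mul] at hst
  rw [gradient, InnerProductSpace.toDual_symm_apply, (hder w).fderiv,
    ContinuousLinearMap.integral_apply (hint _ (by fun_prop))]
  have hS : (volume : Measure (EuclideanSpace ℝ (Fin p))).toSphere Set.univ = p * V := by
    rw [Measure.toSphere_apply_univ, hV, Measure.addHaar_closedBall_eq_addHaar_ball]; simp
  have hemb : MeasurableEmbedding (Subtype.val : sphere (0 : EuclideanSpace ℝ (Fin p)) 1 → _) :=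
    MeasurableEmbedding.subtype_coe isClosed_sphere.measurableSet
  rw [sphereUniform, integral_smul_measure, hemb.integral_map, hS, ballUniform, integral_smul_measure,
    real_inner_smul_left, real_inner_comm, ← integral_inner]
  · simp only [real_inner_smul_right, mul_assoc, integral_const_mul]
    have e : ∀ v : sphere (0 : EuclideanSpace ℝ (Fin p)) 1,
      ξ (w + δ • (v:EuclideanSpace ℝ (Fin p))) * inner ℝ u (v:EuclideanSpace ℝ (Fin p)) =
       inner ℝ (v:EuclideanSpace ℝ (Fin p)) u * ξ (w + δ • (v:EuclideanSpace ℝ (Fin p))) := by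
      intro v; rw [real_inner_comm, mul_comm]
    simp only [e]
    rw [← hst, ← hV, ENNReal.toReal_inv, ENNReal.toReal_inv, ENNReal.toReal_mul, ENNReal.toReal_natCast,
      smul_eq_mul]
    have : (0:ℝ) < p := by exact_mod_cast hp
    field_simp
  · have hc : Continuous (fun x : sphere (0 : EuclideanSpace ℝ (Fin p)) 1 =>
      (((p : ℝ) / δ) * ξ (w + δ • (x : EuclideanSpace ℝ (Fin p)))) • (x : EuclideanSpace ℝ (Fin p))) := by
      fun_prop
    exact hc.integrable_of_hasCompactSupport (HasCompactSupport.of_compactSpace _)
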